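/- Let T > 0 and let v : ℝ × ℝ → ℝ (written v(x,t)) be smooth, satisfy ∂_t v(x,t) = ∂_x^5 v(x,t) for all x ≥ 0 and all t ∈ [0,T], and have right-decay of order 5 on [0,T]. Then the function E(t) = ∫_0^{∞} v(x,t)^2 dx is differentiable on [0,T] and for every t ∈ [0,T], E'(t) = −(∂_x^2 v(0,t))^2 − 2 v(0,t) ∂_x^4 v(0,t) + 2 ∂_x v(0,t) ∂_x^3 v(0,t). -/

import Mathlib

open MeasureTheory Set

/-- `k`-th partial derivative in the first (space) variable of `w : ℝ × ℝ → ℝ`. -/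
noncomputable def pdx (k : ℕ) (w : ℝ × ℝ → ℝ) (x t : ℝ) : ℝ :=
  iteratedDeriv k (fun y => w (y, t)) x

/-- Partial derivative in the second (time) variable of `w : ℝ × ℝ → ℝ`. -/
noncomputable def pdt (w : ℝ × ℝ → ℝ) (x t : ℝ) : ℝ :=
  deriv (fun s => w (x, s)) t

/-- `w` has right-decay of order 5 on `[0,T]`. -/
def RightDecay5 (w : ℝ × ℝ → ℝ) (T : ℝ) : Prop :=
  ∃ C > (0:ℝ), ∀ k ≤ 5, ∀ t ∈ Icc (0:ℝ) T, ∀ x : ℝ, 0 ≤ x →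
    |pdx k w x t| ≤ C * (1 + x ^ 2)⁻¹

open Filter Topology

theorem contDiff_space_slice {v : ℝ × ℝ → ℝ} (hv : ContDiff ℝ (⊤ : ℕ∞) v) (t : ℝ) :
    ContDiff ℝ (⊤ : ℕ∞) (fun y => v (y, t)) := by
  fun_prop

theorem hasDerivAt_pdx {v : ℝ × ℝ → ℝ} (hv : ContDiff ℝ (⊤ : ℕ∞) v) (k : ℕ) (x t : ℝ) :
    HasDerivAt (fun y => pdx k v y t) (pdx (k + 1) v x t) x := by
  have h : Differentiable ℝ (iteratedDeriv k (fun y => v (y, t))) :=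
    (contDiff_space_slice hv t).differentiable_iteratedDeriv k
      (by exact_mod_cast WithTop.coe_lt_top _)
  unfold pdx
  rw [iteratedDeriv_succ]
  exact (h x).hasDerivAt

theorem continuous_pdx {v : ℝ × ℝ → ℝ} (hv : ContDiff ℝ (⊤ : ℕ∞) v) (k : ℕ) (t : ℝ) :
    Continuous (fun x => pdx k v x t) :=
  continuous_iff_continuousAt.2 fun x => (hasDerivAt_pdx hv k x t).continuousAt

theorem hasDerivAt_pdt {v : ℝ × ℝ → ℝ} (hv : ContDiff ℝ (⊤ : ℕ∞) v) (x t : ℝ) :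
    HasDerivAt (fun s => v (x, s)) (pdt v x t) t := by
  have h : ContDiff ℝ (⊤ : ℕ∞) (fun s => v (x, s)) := by fun_prop
  exact (h.differentiable (by simp) t).hasDerivAt

theorem abs_mul_le_of_abs_le_inv_one_add_sq {a b C x : ℝ} (hC : 0 < C)
    (ha : |a| ≤ C * (1 + x ^ 2)⁻¹) (hb : |b| ≤ C * (1 + x ^ 2)⁻¹) :
    |a * b| ≤ C ^ 2 * (1 + x ^ 2)⁻¹ := by
  have h1 : (1 + x ^ 2)⁻¹ ≤ 1 := inv_le_one_of_one_le₀ (by nlinarith [sq_nonneg x])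
  have h0 : 0 < (1 + x ^ 2)⁻¹ := by positivity
  calc |a * b| = |a| * |b| := abs_mul a b
    _ ≤ (C * (1 + x ^ 2)⁻¹) * (C * (1 + x ^ 2)⁻¹) := by gcongr
    _ = C ^ 2 * (1 + x ^ 2)⁻¹ * (1 + x ^ 2)⁻¹ := by ring
    _ ≤ C ^ 2 * (1 + x ^ 2)⁻¹ * 1 := by gcongr
    _ = _ := mul_one _

theorem integrableOn_Ici_of_abs_le_inv_one_add_sq {f : ℝ → ℝ} {C : ℝ} (hf : Continuous f)
    (h : ∀ x, 0 ≤ x → |f x| ≤ C * (1 + x ^ 2)⁻¹) : IntegrableOn f (Ici 0) := by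
  refine Integrable.mono' (integrable_inv_one_add_sq.const_mul C).integrableOn
    hf.aestronglyMeasurable ?_
  filter_upwards [ae_restrict_mem measurableSet_Ici] with x hx using h x hx

theorem tendsto_zero_of_abs_le_inv_one_add_sq {f : ℝ → ℝ} {C : ℝ}
    (h : ∀ x, 0 ≤ x → |f x| ≤ C * (1 + x ^ 2)⁻¹) : Tendsto f atTop (𝓝 0) := by
  have h2 : Tendsto (fun x : ℝ => C * (1 + x ^ 2)⁻¹) atTop (𝓝 0) := by
    have : Tendsto (fun x : ℝ => 1 + x ^ 2) atTop atTop :=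
      tendsto_atTop_add_const_left _ _ (tendsto_pow_atTop two_ne_zero)
    simpa using this.inv_tendsto_atTop.const_mul C
  refine squeeze_zero_norm' ?_ h2
  filter_upwards [eventually_ge_atTop 0] with x hx using h x hx

/-- Spatial integration by parts: the boundary terms of `2 ∫ v ∂ₓ⁵ v` on the half-line. -/
theorem integral_Ici_two_mul_pdx_five {v : ℝ × ℝ → ℝ} (hv : ContDiff ℝ (⊤ : ℕ∞) v)
    {C t : ℝ} (hC : 0 < C)
    (hdecay : ∀ k ≤ 5, ∀ x : ℝ, 0 ≤ x → |pdx k v x t| ≤ C * (1 + x ^ 2)⁻¹) :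
    ∫ x in Ici (0 : ℝ), 2 * (pdx 0 v x t * pdx 5 v x t) =
      -(pdx 2 v 0 t) ^ 2 - 2 * pdx 0 v 0 t * pdx 4 v 0 t + 2 * pdx 1 v 0 t * pdx 3 v 0 t := by
  have hprod (i j : ℕ) (hi : i ≤ 5) (hj : j ≤ 5) (x : ℝ) (hx : 0 ≤ x) :
      |pdx i v x t * pdx j v x t| ≤ C ^ 2 * (1 + x ^ 2)⁻¹ :=
    abs_mul_le_of_abs_le_inv_one_add_sq hC (hdecay i hi x hx) (hdecay j hj x hx)
  have hlim (i j : ℕ) (hi : i ≤ 5) (hj : j ≤ 5) :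
      Tendsto (fun x => pdx i v x t * pdx j v x t) atTop (𝓝 0) :=
    tendsto_zero_of_abs_le_inv_one_add_sq (hprod i j hi hj)
  have hint : IntegrableOn (fun x => 2 * (pdx 0 v x t * pdx 5 v x t)) (Ioi 0) :=
    ((integrableOn_Ici_of_abs_le_inv_one_add_sq
      ((continuous_pdx hv 0 t).mul (continuous_pdx hv 5 t))
      (hprod 0 5 (by norm_num) le_rfl)).mono_set Ioi_subset_Ici_self).const_mul 2
  have hderiv (x : ℝ) : HasDerivAt
      (fun y => 2 * (pdx 0 v y t * pdx 4 v y t) - 2 * (pdx 1 v y t * pdx 3 v y t)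
        + pdx 2 v y t * pdx 2 v y t) (2 * (pdx 0 v x t * pdx 5 v x t)) x := by
    have h := ((((hasDerivAt_pdx hv 0 x t).mul (hasDerivAt_pdx hv 4 x t)).const_mul 2).sub
      (((hasDerivAt_pdx hv 1 x t).mul (hasDerivAt_pdx hv 3 x t)).const_mul 2)).add
      ((hasDerivAt_pdx hv 2 x t).mul (hasDerivAt_pdx hv 2 x t))
    refine h.congr_deriv ?_
    norm_num
    ring
  have htend := (((hlim 0 4 (by norm_num) (by norm_num)).const_mul 2).sub
    ((hlim 1 3 (by norm_num) (by norm_num)).const_mul 2)).add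
    (hlim 2 2 (by norm_num) (by norm_num))
  rw [integral_Ici_eq_integral_Ioi,
    integral_Ioi_of_hasDerivAt_of_tendsto' (fun x _ => hderiv x) hint htend]
  ring

/-- Differentiation under the integral sign, for derivatives within a convex set of parameters. -/
theorem hasDerivWithinAt_integral_of_dominated {α : Type*} [MeasurableSpace α] {μ : Measure α}
    {S : Set ℝ} (hS : Convex ℝ S) {F F' : ℝ → α → ℝ} {bound : α → ℝ} {t : ℝ} (ht : t ∈ S)
    (hF : ∀ s ∈ S, Integrable (F s) μ)
    (hderiv : ∀ᵐ x ∂μ, ∀ s ∈ S, HasDerivWithinAt (fun r => F r x) (F' s x) S s)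
    (hbound : ∀ᵐ x ∂μ, ∀ s ∈ S, |F' s x| ≤ bound x) (hint : Integrable bound μ) :
    HasDerivWithinAt (fun s => ∫ x, F s x ∂μ) (∫ x, F' t x ∂μ) S t := by
  rw [hasDerivWithinAt_iff_tendsto_slope]
  have hlim : Tendsto (fun s => ∫ x, slope (fun r => F r x) t s ∂μ) (𝓝[S \ {t}] t)
      (𝓝 (∫ x, F' t x ∂μ)) := by
    refine tendsto_integral_filter_of_dominated_convergence bound ?_ ?_ hint ?_
    · filter_upwards [self_mem_nhdsWithin] with s hs
      simp only [slope_def_field]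
      exact (((hF s hs.1).sub (hF t ht)).div_const _).aestronglyMeasurable
    · filter_upwards [self_mem_nhdsWithin] with s hs
      filter_upwards [hderiv, hbound] with x hd hb
      have hmvt := hS.norm_image_sub_le_of_norm_hasDerivWithin_le hd hb ht hs.1
      rw [slope_def_field, norm_div]
      exact div_le_of_le_mul₀ (norm_nonneg _) ((abs_nonneg _).trans (hb t ht)) hmvt
    · filter_upwards [hderiv] with x hd
      exact hasDerivWithinAt_iff_tendsto_slope.1 (hd t ht)
  refine hlim.congr' ?_
  filter_upwards [self_mem_nhdsWithin] with s hs
  simp only [slope_def_field]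
  rw [integral_div, integral_sub (hF s hs.1) (hF t ht)]

/-- Boundary energy identity for the linearized Kawahara equation
`∂ₜ v = ∂ₓ⁵ v` on the right half-line `(0, ∞)`. -/
theorem kawahara_right_energy_identity
    (T : ℝ) (hT : 0 < T) (v : ℝ × ℝ → ℝ)
    (hsmooth : ContDiff ℝ (⊤ : ℕ∞) v)
    (heq : ∀ x : ℝ, 0 ≤ x → ∀ t ∈ Icc (0:ℝ) T, pdt v x t = pdx 5 v x t)
    (hdecay : RightDecay5 v T) :
    ∀ t ∈ Icc (0:ℝ) T,
      HasDerivWithinAt (fun s => ∫ x in Ici (0:ℝ), (v (x, s)) ^ 2)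
        (-(pdx 2 v 0 t) ^ 2 - 2 * v (0, t) * pdx 4 v 0 t
          + 2 * pdx 1 v 0 t * pdx 3 v 0 t) (Icc (0:ℝ) T) t := by
  obtain ⟨C, hC, hdecay⟩ := hdecay
  intro t ht
  have hzero (x s : ℝ) : pdx 0 v x s = v (x, s) := by simp [pdx]
  have hv0 (s : ℝ) (hs : s ∈ Icc (0 : ℝ) T) (x : ℝ) (hx : 0 ≤ x) :
      |v (x, s)| ≤ C * (1 + x ^ 2)⁻¹ := by
    simpa only [hzero] using hdecay 0 (by norm_num) s hs x hx
  have hmain := hasDerivWithinAt_integral_of_dominated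
    (μ := volume.restrict (Ici (0 : ℝ))) (convex_Icc (0 : ℝ) T)
    (F := fun s x => v (x, s) ^ 2) (F' := fun s x => 2 * (pdx 0 v x s * pdx 5 v x s))
    (bound := fun x => 2 * C ^ 2 * (1 + x ^ 2)⁻¹) ht ?_ ?_ ?_
    (integrable_inv_one_add_sq.const_mul _).integrableOn
  · have hparts := integral_Ici_two_mul_pdx_five hsmooth hC
      (fun k hk x hx => hdecay k hk t ht x hx)
    rw [hparts, hzero] at hmain
    exact hmain
  · intro s hs
    refine integrableOn_Ici_of_abs_le_inv_one_add_sq (C := C ^ 2)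
      ((contDiff_space_slice hsmooth s).continuous.pow 2) fun x hx => ?_
    rw [sq]
    exact abs_mul_le_of_abs_le_inv_one_add_sq hC (hv0 s hs x hx) (hv0 s hs x hx)
  · filter_upwards [ae_restrict_mem measurableSet_Ici] with x hx s hs
    refine (((hasDerivAt_pdt hsmooth x s).pow 2).congr_deriv ?_).hasDerivWithinAt
    rw [heq x hx s hs, hzero]
    norm_num
    ring
  · filter_upwards [ae_restrict_mem measurableSet_Ici] with x hx s hs
    rw [abs_mul, abs_two, mul_assoc]
    gcongr
    exact abs_mul_le_of_abs_le_inv_one_add_sq hC (hdecay 0 (by norm_num) s hs x hx)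
      (hdecay 5 le_rfl s hs x hx)
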